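/- There exist constants δ, D > 0 such that the following holds for Thompson's group T. For all g1, g2 ∈ T with N(g1) ≥ 4 and N(g2) ≥ 4, there is a word w in the letters {x0^{±1}, x1^{±1}, c1^{±1}} of length at most D·(|g1|_B + |g2|_B) such that g1·w = g2 as elements of T, and for every prefix w' of w (evaluated as an element of T) one has |g1·w'|_B ≥ δ·min{|g1|_B, |g2|_B}. -/

import Mathlib

/-!
Formalization framework for Thompson's groups `F ≤ T ≤ V` acting on the
Cantor set `{0,1}^ℕ`.  Elements of `V` are permutations of the Cantor set
admitting a finite table of branches `u → v` (complete prefix codes) with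
`g(uω) = vω`.  Products in the paper are composed left-to-right, i.e. the
paper's `g·h` is `Equiv.trans g h` (equivalently `h * g` in `Equiv.Perm`).
-/

abbrev CSeq : Type := ℕ → Bool
abbrev VPerm : Type := Equiv.Perm CSeq

/-- Concatenation of a finite binary word with an infinite binary word. -/
def app (u : List Bool) (ω : CSeq) : CSeq := fun n =>
  if h : n < u.length then u[n] else ω (n - u.length)

/-- The finite word `u` is a prefix of the infinite word `ω`. -/
def IsPref (u : List Bool) (ω : CSeq) : Prop := ∃ ω', ω = app u ω'

/-- The finite table of branches `T` represents the permutation `g` of the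
Cantor set: the domain codes and the range codes each form a complete prefix
code, and `g` maps `uω ↦ vω` for every branch `(u, v) ∈ T`. -/
def Represents (g : VPerm) (T : Finset (List Bool × List Bool)) : Prop :=
  (∀ ω : CSeq, ∃! p : List Bool × List Bool, p ∈ T ∧ IsPref p.1 ω) ∧
  (∀ ω : CSeq, ∃! p : List Bool × List Bool, p ∈ T ∧ IsPref p.2 ω) ∧
  (∀ p ∈ T, ∀ ω : CSeq, g (app p.1 ω) = app p.2 ω)

/-- A table of branches is reduced if it contains no pair of branches
`u0 → v0`, `u1 → v1`. -/
def Reduced (T : Finset (List Bool × List Bool)) : Prop :=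
  ∀ u v : List Bool,
    ¬((u ++ [false], v ++ [false]) ∈ T ∧ (u ++ [true], v ++ [true]) ∈ T)

/-- Membership in Thompson's group `V`. -/
def InV (g : VPerm) : Prop := ∃ T, Represents g T

/-- `u → v` is a branch of the (unique) reduced representation of `g`. -/
def IsBranch (g : VPerm) (u v : List Bool) : Prop :=
  ∃ T, Represents g T ∧ Reduced T ∧ (u, v) ∈ T

/-- `N(g)`: the number of branches of the reduced representation of `g`. -/
noncomputable def Nbr (g : VPerm) : ℕ :=
  sInf {n | ∃ T, Represents g T ∧ Reduced T ∧ T.card = n}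

/-- `ℓ0(g)`: the unique `ℓ ≥ 1` such that `0^ℓ` is the range code of some
branch of `g`. -/
noncomputable def ell0 (g : VPerm) : ℕ :=
  sInf {ℓ | 1 ≤ ℓ ∧ ∃ u, IsBranch g u (List.replicate ℓ false)}

/-- `ℓ1(g)`: the unique `ℓ ≥ 1` such that `1^ℓ` is the range code of some
branch of `g`. -/
noncomputable def ell1 (g : VPerm) : ℕ :=
  sInf {ℓ | 1 ≤ ℓ ∧ ∃ u, IsBranch g u (List.replicate ℓ true)}

/-- `w` is a strict prefix of the range code of some branch of `g`. -/
def StrictPrefOfBranch (g : VPerm) (w : List Bool) : Prop :=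
  ∃ u v, IsBranch g u v ∧ w <+: v ∧ w ≠ v

/-- Strict lexicographic order on infinite binary words. -/
def lexLt (a b : CSeq) : Prop :=
  ∃ n, (∀ i < n, a i = b i) ∧ a n = false ∧ b n = true

/-- Membership in Thompson's group `F`: an element of `V` preserving the
(lexicographic) order of the Cantor set. -/
def InF (g : VPerm) : Prop :=
  InV g ∧ ∀ a b : CSeq, lexLt a b → lexLt (g a) (g b)

/-- `(a, b, c)` is a (strict) cyclically ordered triple. -/
def cyc3 (a b c : CSeq) : Prop :=
  (lexLt a b ∧ lexLt b c) ∨ (lexLt b c ∧ lexLt c a) ∨ (lexLt c a ∧ lexLt a b)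

/-- Membership in Thompson's group `T`: an element of `V` preserving the
cyclic order of the Cantor set. -/
def InT (g : VPerm) : Prop :=
  InV g ∧ ∀ a b c : CSeq, cyc3 a b c → cyc3 (g a) (g b) (g c)

/-- Word length of `g` with respect to the generating set `S` (letters are
elements of `S` or inverses of elements of `S`). -/
noncomputable def wlen (S : Set VPerm) (g : VPerm) : ℕ :=
  sInf {n | ∃ l : List VPerm,
    l.length = n ∧ (∀ x ∈ l, x ∈ S ∨ x⁻¹ ∈ S) ∧ l.prod = g}

/-- `h'` is the copy `h_{[u]}` of `h` supported on the cylinder of `u`. -/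
def IsCopy (h : VPerm) (u : List Bool) (h' : VPerm) : Prop :=
  (∀ ω : CSeq, h' (app u ω) = app u (h ω)) ∧
  (∀ ω : CSeq, ¬ IsPref u ω → h' ω = ω)

/-- Evaluation (left-to-right) of the word `w` starting at the element `g`:
the paper's product `g · w`. -/
def wordEval (g : VPerm) (w : List VPerm) : VPerm :=
  w.foldl (fun a b => a.trans b) g

/-- Branches of the generator `x0`: `00→0`, `01→10`, `1→11`. -/
def x0T : Finset (List Bool × List Bool) :=
  {([false, false], [false]), ([false, true], [true, false]),
   ([true], [true, true])}

/-- Branches of the generator `x1`: `0→0`, `100→10`, `101→110`, `11→111`. -/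
def x1T : Finset (List Bool × List Bool) :=
  {([false], [false]), ([true, false, false], [true, false]),
   ([true, false, true], [true, true, false]),
   ([true, true], [true, true, true])}

/-- Branches of the generator `c1`: `0→10`, `10→11`, `11→0`. -/
def c1T : Finset (List Bool × List Bool) :=
  {([false], [true, false]), ([true, false], [true, true]),
   ([true, true], [false])}

/-- Branches of the generator `π0`: `0→10`, `10→0`, `11→11`. -/
def pi0T : Finset (List Bool × List Bool) :=
  {([false], [true, false]), ([true, false], [false]),
   ([true, true], [true, true])}

/-- The standard generators `x_j`, `j ≥ 0`, of `F`: for `r ≥ 1`,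
`x_{r+1} = x0^{-r} · x1 · x0^{r}` in the left-to-right convention of the
paper, i.e. `x0 ^ r * x1 * (x0⁻¹) ^ r` in `Equiv.Perm`. -/
def xseq (x0 x1 : VPerm) : ℕ → VPerm
  | 0 => x0
  | r + 1 => x0 ^ r * x1 * (x0⁻¹) ^ r


/-- The infinite word obtained by putting the letter `b` in front of `ω`. -/
def consSeq (b : Bool) (ω : CSeq) : CSeq
  | 0 => b
  | n + 1 => ω n

/-- The infinite word `ω` without its first letter. -/
def tailSeq (ω : CSeq) : CSeq := fun n => ω (n + 1)

@[simp] lemma consSeq_zero (b : Bool) (ω : CSeq) : consSeq b ω 0 = b := rfl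

@[simp] lemma consSeq_succ (b : Bool) (ω : CSeq) (n : ℕ) : consSeq b ω (n + 1) = ω n := rfl

@[simp] lemma tailSeq_consSeq (b : Bool) (ω : CSeq) : tailSeq (consSeq b ω) = ω := rfl

lemma consSeq_tailSeq (ω : CSeq) : consSeq (ω 0) (tailSeq ω) = ω := by
  funext n
  cases n <;> rfl

@[simp] lemma consSeq_inj {a b : Bool} {ω η : CSeq} :
    consSeq a ω = consSeq b η ↔ a = b ∧ ω = η := by
  refine ⟨fun h => ⟨congrFun h 0, ?_⟩, fun h => by rw [h.1, h.2]⟩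
  simpa using congrArg tailSeq h

lemma exists_consSeq (ω : CSeq) :
    (∃ η, ω = consSeq false η) ∨ ∃ η, ω = consSeq true η := by
  rcases h : ω 0 with _ | _
  · exact Or.inl ⟨tailSeq ω, by rw [← h, consSeq_tailSeq]⟩
  · exact Or.inr ⟨tailSeq ω, by rw [← h, consSeq_tailSeq]⟩

@[simp] lemma app_nil (ω : CSeq) : app [] ω = ω := by
  funext n
  simp [app]

@[simp] lemma app_cons (b : Bool) (u : List Bool) (ω : CSeq) :
    app (b :: u) ω = consSeq b (app u ω) := by
  funext n
  cases n with
  | zero => simp [app]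
  | succ n => simp [app]

@[simp] lemma app_append (u v : List Bool) (ω : CSeq) : app (u ++ v) ω = app u (app v ω) := by
  induction u with
  | nil => simp
  | cons b u ih => simp [ih]

@[simp] lemma app_left_inj {u : List Bool} {ω η : CSeq} : app u ω = app u η ↔ ω = η := by
  induction u with
  | nil => simp
  | cons b u ih => simp [ih]

lemma eq_nil_of_app_eq_self {u : List Bool} (h : ∀ ω, app u ω = ω) : u = [] := by
  cases u with
  | nil => rfl
  | cons b u =>
    have := congrFun (h (fun _ => !b)) 0
    simp at this

lemma word_eq_of_app_eq {u v : List Bool} (h : ∀ ω, app u ω = app v ω) : u = v := by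
  induction u generalizing v with
  | nil => exact (eq_nil_of_app_eq_self fun ω => by rw [← h ω, app_nil]).symm
  | cons b u ih =>
    cases v with
    | nil => exact eq_nil_of_app_eq_self fun ω => by rw [h ω, app_nil]
    | cons c v =>
      have h' : ∀ ω, b = c ∧ app u ω = app v ω := by simpa using h
      rw [(h' (fun _ => false)).1, ih fun ω => (h' ω).2]

lemma prefix_of_app_eq_app {u v : List Bool} {ω η : CSeq} (h : app u ω = app v η)
    (hl : u.length ≤ v.length) : u <+: v := by
  induction u generalizing v with
  | nil => exact List.nil_prefix
  | cons b u ih =>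
    cases v with
    | nil => simp at hl
    | cons c v =>
      simp only [app_cons, consSeq_inj] at h
      rw [h.1, List.prefix_cons_inj]
      exact ih h.2 (by simpa using hl)

lemma app_replicate_succ (b : Bool) (n : ℕ) (ω : CSeq) :
    app (List.replicate (n + 1) b) ω = app (List.replicate n b) (consSeq b ω) := by
  rw [List.replicate_succ', app_append]
  simp

lemma app_replicate_const (b : Bool) (n : ℕ) :
    app (List.replicate n b) (fun _ => b) = fun _ => b := by
  induction n with
  | zero => simp
  | succ n ih =>
    rw [List.replicate_succ, app_cons, ih]
    funext k
    cases k <;> rfl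

lemma eq_replicate_of_app_const {b : Bool} {v : List Bool}
    (h : app v (fun _ => b) = fun _ => b) : v = List.replicate v.length b := by
  have := prefix_of_app_eq_app (h.trans (app_replicate_const b v.length).symm) (by simp)
  exact this.eq_of_length (by simp)

/-! ### Prefix replacement on cylinders -/

/-- `g` acts on the cylinder of `u` by replacing the prefix `u` with another finite word. -/
def PrefixReplaces (g : VPerm) (u : List Bool) : Prop :=
  ∃ v, ∀ ω, g (app u ω) = app v ω

lemma PrefixReplaces.append {g : VPerm} {u : List Bool} (h : PrefixReplaces g u)
    (r : List Bool) : PrefixReplaces g (u ++ r) := by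
  obtain ⟨v, hv⟩ := h
  exact ⟨v ++ r, fun ω => by simp [hv]⟩

lemma PrefixReplaces.of_prefix {g : VPerm} {u w : List Bool} (h : PrefixReplaces g u)
    (hw : u <+: w) : PrefixReplaces g w := by
  obtain ⟨r, rfl⟩ := hw
  exact h.append r

lemma nil_of_forall_apply_eq_app {g : VPerm} {v : List Bool} (h : ∀ ω, g ω = app v ω) :
    v = [] := by
  cases v with
  | nil => rfl
  | cons b v =>
    have := congrFun (h (g⁻¹ fun _ => !b)) 0
    simp at this

lemma eq_one_of_prefixReplaces_nil {g : VPerm} (h : PrefixReplaces g []) : g = 1 := by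
  obtain ⟨v, hv⟩ := h
  simp only [app_nil] at hv
  obtain rfl := nil_of_forall_apply_eq_app hv
  exact Equiv.ext fun ω => by simp [hv]

/-- `g` replaces prefixes on every cylinder of depth at least `d`. -/
def HasDepth (g : VPerm) (d : ℕ) : Prop := ∀ u : List Bool, d ≤ u.length → PrefixReplaces g u

lemma HasDepth.one : HasDepth 1 0 := fun u _ => ⟨u, fun _ => rfl⟩

lemma HasDepth.mul {g h : VPerm} {d e : ℕ} (hg : HasDepth g d) (hh : HasDepth h e) :
    HasDepth (g * h) (d + e) := by
  intro u hu
  obtain ⟨v, hv⟩ := hh (u.take e) (by rw [List.length_take]; omega)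
  obtain ⟨w, hw⟩ := hg (v ++ u.drop e) (by rw [List.length_append, List.length_drop]; omega)
  refine ⟨w, fun ω => ?_⟩
  rw [Equiv.Perm.mul_apply, ← hw]
  conv_lhs => rw [← List.take_append_drop e u]
  rw [app_append, hv, app_append]

lemma Represents.inv {g : VPerm} {T : Finset (List Bool × List Bool)} (h : Represents g T) :
    Represents g⁻¹ (T.image Prod.swap) := by
  obtain ⟨h1, h2, h3⟩ := h
  refine ⟨fun ω => ?_, fun ω => ?_, ?_⟩
  · obtain ⟨p, ⟨hp, hpω⟩, hu⟩ := h2 ω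
    refine ⟨p.swap, ⟨Finset.mem_image_of_mem _ hp, hpω⟩, ?_⟩
    rintro q ⟨hq, hqω⟩
    obtain ⟨q, hq', rfl⟩ := Finset.mem_image.1 hq
    rw [hu q ⟨hq', hqω⟩]
  · obtain ⟨p, ⟨hp, hpω⟩, hu⟩ := h1 ω
    refine ⟨p.swap, ⟨Finset.mem_image_of_mem _ hp, hpω⟩, ?_⟩
    rintro q ⟨hq, hqω⟩
    obtain ⟨q, hq', rfl⟩ := Finset.mem_image.1 hq
    rw [hu q ⟨hq', hqω⟩]
  · intro q hq ω
    obtain ⟨q, hq', rfl⟩ := Finset.mem_image.1 hq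
    rw [Equiv.Perm.inv_eq_iff_eq]
    exact (h3 q hq' ω).symm

lemma Represents.hasDepth {g : VPerm} {T : Finset (List Bool × List Bool)}
    (h : Represents g T) {d : ℕ} (hd : ∀ p ∈ T, p.1.length ≤ d) : HasDepth g d := by
  intro u hu
  obtain ⟨p, ⟨hp, η, hη⟩, -⟩ := h.1 (app u fun _ => false)
  have hpu := prefix_of_app_eq_app hη.symm ((hd p hp).trans hu)
  exact PrefixReplaces.of_prefix ⟨p.2, h.2.2 p hp⟩ hpu

lemma InV.exists_hasDepth {g : VPerm} (h : InV g) : ∃ d, HasDepth g d := by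
  obtain ⟨T, hT⟩ := h
  exact ⟨T.sup fun p => p.1.length, hT.hasDepth fun p hp =>
    Finset.le_sup (f := fun p : List Bool × List Bool => p.1.length) hp⟩

/-! ### Lexicographic order -/

@[simp] lemma lexLt_consSeq {a b : Bool} {ω η : CSeq} :
    lexLt (consSeq a ω) (consSeq b η) ↔ (a = false ∧ b = true) ∨ (a = b ∧ lexLt ω η) := by
  constructor
  · rintro ⟨n, h1, h2, h3⟩
    cases n with
    | zero => exact Or.inl ⟨h2, h3⟩
    | succ n =>
      exact Or.inr ⟨h1 0 n.succ_pos, n, fun i hi => h1 (i + 1) (by omega), h2, h3⟩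
  · rintro (⟨rfl, rfl⟩ | ⟨rfl, n, h1, h2, h3⟩)
    · exact ⟨0, by simp, rfl, rfl⟩
    · refine ⟨n + 1, fun i hi => ?_, h2, h3⟩
      cases i with
      | zero => rfl
      | succ i => exact h1 i (by omega)

lemma lexLt_zero_of_ne {ω : CSeq} (h : ω ≠ fun _ => false) : lexLt (fun _ => false) ω := by
  classical
  have h' : ∃ n, ω n = true := by
    by_contra hn
    exact h (funext fun n => by simpa using fun hω => hn ⟨n, hω⟩)
  refine ⟨Nat.find h', fun i hi => ?_, rfl, Nat.find_spec h'⟩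
  simpa using (Nat.find_min h' hi)

lemma not_lexLt_zero (ω : CSeq) : ¬ lexLt ω fun _ => false := by
  rintro ⟨n, -, -, h⟩
  simp at h

/-- `g` preserves the lexicographic order. -/
def OrderPreserving (g : VPerm) : Prop := ∀ a b : CSeq, lexLt a b → lexLt (g a) (g b)

lemma OrderPreserving.mul {g h : VPerm} (hg : OrderPreserving g) (hh : OrderPreserving h) :
    OrderPreserving (g * h) := fun a b hab => hg _ _ (hh a b hab)

lemma OrderPreserving.apply_zero {g : VPerm} (hg : OrderPreserving g) :
    g (fun _ => false) = fun _ => false := by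
  by_contra h
  have h1 : g⁻¹ (fun _ => false) ≠ fun _ => false := fun h2 =>
    h (Equiv.Perm.inv_eq_iff_eq.1 h2).symm
  have h2 := hg _ _ (lexLt_zero_of_ne h1)
  rw [← Equiv.Perm.mul_apply, mul_inv_cancel, Equiv.Perm.one_apply] at h2
  exact not_lexLt_zero _ h2

/-! ### Copies on half of the Cantor set -/

/-- The copy of `f` supported on the cylinder of the one-letter word `b`. -/
def halfCopy (b : Bool) (f : VPerm) : VPerm where
  toFun ω := if ω 0 = b then consSeq b (f (tailSeq ω)) else ω
  invFun ω := if ω 0 = b then consSeq b (f.symm (tailSeq ω)) else ω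
  left_inv ω := by
    by_cases h : ω 0 = b
    · simp only [h, if_true, consSeq_zero, tailSeq_consSeq, Equiv.symm_apply_apply]
      subst h
      exact consSeq_tailSeq ω
    · simp [h]
  right_inv ω := by
    by_cases h : ω 0 = b
    · simp only [h, if_true, consSeq_zero, tailSeq_consSeq, Equiv.apply_symm_apply]
      subst h
      exact consSeq_tailSeq ω
    · simp [h]

lemma halfCopy_consSeq (b c : Bool) (f : VPerm) (ω : CSeq) :
    halfCopy b f (consSeq c ω) = if c = b then consSeq b (f ω) else consSeq c ω := rfl

lemma perm_ext_consSeq {g h : VPerm} (h0 : ∀ ω, g (consSeq false ω) = h (consSeq false ω))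
    (h1 : ∀ ω, g (consSeq true ω) = h (consSeq true ω)) : g = h := by
  refine Equiv.ext fun ω => ?_
  rcases exists_consSeq ω with ⟨η, rfl⟩ | ⟨η, rfl⟩
  exacts [h0 η, h1 η]

/-- Copying to the cylinder of `b` is a group homomorphism. -/
def halfCopyHom (b : Bool) : VPerm →* VPerm :=
  MonoidHom.mk' (halfCopy b) fun f g => by
    refine perm_ext_consSeq (fun ω => ?_) fun ω => ?_ <;> cases b <;>
      simp [halfCopy_consSeq]

lemma halfCopyHom_consSeq (b c : Bool) (f : VPerm) (ω : CSeq) :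
    halfCopyHom b f (consSeq c ω) = if c = b then consSeq b (f ω) else consSeq c ω := rfl

lemma exists_eq_halfCopyHom {b : Bool} {g : VPerm}
    (hg : ∀ ω, g (consSeq (!b) ω) = consSeq (!b) ω) : ∃ f, g = halfCopyHom b f := by
  have key : ∀ k : VPerm, (∀ ω, k (consSeq (!b) ω) = consSeq (!b) ω) →
      ∀ ω, k (consSeq b ω) = consSeq b (tailSeq (k (consSeq b ω))) := by
    intro k hk ω
    have h0 : k (consSeq b ω) 0 = b := by
      by_contra h
      have h' : k (consSeq b ω) 0 = !b := by simpa [Bool.eq_not] using h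
      have h2 := consSeq_tailSeq (k (consSeq b ω))
      rw [h', ← hk, k.injective.eq_iff, consSeq_inj] at h2
      simp at h2
    conv_lhs => rw [← consSeq_tailSeq (k (consSeq b ω)), h0]
  have hg' : ∀ ω, g⁻¹ (consSeq (!b) ω) = consSeq (!b) ω := fun ω =>
    Equiv.Perm.inv_eq_iff_eq.2 (hg ω).symm
  let f : VPerm :=
    { toFun := fun ω => tailSeq (g (consSeq b ω))
      invFun := fun ω => tailSeq (g⁻¹ (consSeq b ω))
      left_inv := fun ω => by simp [← key g hg]
      right_inv := fun ω => by
        show tailSeq (g (consSeq b (tailSeq (g⁻¹ (consSeq b ω))))) = ω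
        rw [← key g⁻¹ hg', ← Equiv.Perm.mul_apply, mul_inv_cancel]
        rfl }
  refine ⟨f, ?_⟩
  have hb : ∀ ω, g (consSeq b ω) = halfCopyHom b f (consSeq b ω) := fun ω => by
    rw [halfCopyHom_consSeq, if_pos rfl]
    exact key g hg ω
  have hnb : ∀ ω, g (consSeq (!b) ω) = halfCopyHom b f (consSeq (!b) ω) := fun ω => by
    rw [halfCopyHom_consSeq, if_neg (by simp), hg]
  cases b
  exacts [perm_ext_consSeq hb hnb, perm_ext_consSeq hnb hb]

lemma prefixReplaces_of_halfCopyHom {b : Bool} {f : VPerm} {u : List Bool}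
    (h : PrefixReplaces (halfCopyHom b f) (b :: u)) : PrefixReplaces f u := by
  obtain ⟨v, hv⟩ := h
  simp only [app_cons, halfCopyHom_consSeq, if_true] at hv
  cases v with
  | nil =>
    have := congrFun (hv fun _ => !b) 0
    simp at this
  | cons c v => exact ⟨v, fun ω => by simpa using (consSeq_inj.1 ((hv ω).trans (app_cons c v ω))).2⟩

lemma HasDepth.of_halfCopyHom {b : Bool} {f : VPerm} {d : ℕ}
    (h : HasDepth (halfCopyHom b f) d) : HasDepth f d := fun u hu =>
  prefixReplaces_of_halfCopyHom (h (b :: u) (by simp; omega))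

/-! ### The generators -/

/-- The explicit action of `x0`, `x1`, `c1` and their inverses on infinite words. -/
def IsGeneratingTriple (x0 x1 c1 : VPerm) : Prop := ∀ ω : CSeq,
  x0 (consSeq false (consSeq false ω)) = consSeq false ω ∧
  x0 (consSeq false (consSeq true ω)) = consSeq true (consSeq false ω) ∧
  x0 (consSeq true ω) = consSeq true (consSeq true ω) ∧
  x0⁻¹ (consSeq false ω) = consSeq false (consSeq false ω) ∧
  x0⁻¹ (consSeq true (consSeq false ω)) = consSeq false (consSeq true ω) ∧
  x0⁻¹ (consSeq true (consSeq true ω)) = consSeq true ω ∧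
  x1 (consSeq false ω) = consSeq false ω ∧
  x1 (consSeq true (consSeq false (consSeq false ω))) = consSeq true (consSeq false ω) ∧
  x1 (consSeq true (consSeq false (consSeq true ω))) =
    consSeq true (consSeq true (consSeq false ω)) ∧
  x1 (consSeq true (consSeq true ω)) = consSeq true (consSeq true (consSeq true ω)) ∧
  x1⁻¹ (consSeq false ω) = consSeq false ω ∧
  x1⁻¹ (consSeq true (consSeq false ω)) = consSeq true (consSeq false (consSeq false ω)) ∧
  x1⁻¹ (consSeq true (consSeq true (consSeq false ω))) =
    consSeq true (consSeq false (consSeq true ω)) ∧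
  x1⁻¹ (consSeq true (consSeq true (consSeq true ω))) = consSeq true (consSeq true ω) ∧
  c1 (consSeq false ω) = consSeq true (consSeq false ω) ∧
  c1 (consSeq true (consSeq false ω)) = consSeq true (consSeq true ω) ∧
  c1 (consSeq true (consSeq true ω)) = consSeq false ω ∧
  c1⁻¹ (consSeq false ω) = consSeq true (consSeq true ω) ∧
  c1⁻¹ (consSeq true (consSeq false ω)) = consSeq false ω ∧
  c1⁻¹ (consSeq true (consSeq true ω)) = consSeq true (consSeq false ω)

lemma isGeneratingTriple_of_represents {x0 x1 c1 : VPerm} (hx0 : Represents x0 x0T)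
    (hx1 : Represents x1 x1T) (hc1 : Represents c1 c1T) : IsGeneratingTriple x0 x1 c1 := by
  have h0 := hx0.2.2
  have h1 := hx1.2.2
  have h2 := hc1.2.2
  simp only [x0T, x1T, c1T, Finset.mem_insert, Finset.mem_singleton, forall_eq_or_imp,
    forall_eq, app_cons, app_nil] at h0 h1 h2
  intro ω
  simp only [Equiv.Perm.inv_eq_iff_eq, h0, h1, h2, and_self]

section Generators

variable {x0 x1 c1 : VPerm}

/-- The element rotating the cylinder of `0` onto the cylinder of `1`. -/
def halfTurn (x0 c1 : VPerm) : VPerm := x0⁻¹ * c1⁻¹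

lemma halfCopyHom_x0 (H : IsGeneratingTriple x0 x1 c1) : halfCopyHom true x0 = x1 := by
  unfold IsGeneratingTriple at H
  refine perm_ext_consSeq (fun ω => ?_) fun ω => ?_
  · simp [halfCopyHom_consSeq, H]
  · rcases exists_consSeq ω with ⟨ω, rfl⟩ | ⟨ω, rfl⟩
    · rcases exists_consSeq ω with ⟨ω, rfl⟩ | ⟨ω, rfl⟩ <;> simp [halfCopyHom_consSeq, H]
    · simp [halfCopyHom_consSeq, H]

lemma halfCopyHom_halfCopyHom (H : IsGeneratingTriple x0 x1 c1) (f : VPerm) :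
    halfCopyHom true (halfCopyHom true f) = x0 * halfCopyHom true f * x0⁻¹ := by
  unfold IsGeneratingTriple at H
  refine perm_ext_consSeq (fun ω => ?_) fun ω => ?_
  · simp only [Equiv.Perm.mul_apply, halfCopyHom_consSeq, H]
    simp [H]
  · rcases exists_consSeq ω with ⟨ω, rfl⟩ | ⟨ω, rfl⟩ <;>
      simp only [Equiv.Perm.mul_apply, halfCopyHom_consSeq, H, if_true, Bool.false_eq_true, if_false]

lemma halfTurn_consSeq_false (H : IsGeneratingTriple x0 x1 c1) (ω : CSeq) :
    halfTurn x0 c1 (consSeq false ω) = consSeq true ω := by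
  unfold IsGeneratingTriple at H
  simp only [halfTurn, Equiv.Perm.mul_apply, H]

lemma halfTurn_consSeq_true (H : IsGeneratingTriple x0 x1 c1) (ω : CSeq) :
    halfTurn x0 c1 (consSeq true ω) = consSeq false ω := by
  unfold IsGeneratingTriple at H
  rcases exists_consSeq ω with ⟨ω, rfl⟩ | ⟨ω, rfl⟩ <;>
    simp only [halfTurn, Equiv.Perm.mul_apply, H]

lemma halfCopyHom_false (H : IsGeneratingTriple x0 x1 c1) (f : VPerm) :
    halfCopyHom false f = (halfTurn x0 c1)⁻¹ * halfCopyHom true f * halfTurn x0 c1 := by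
  rw [mul_assoc, eq_inv_mul_iff_mul_eq]
  refine perm_ext_consSeq (fun ω => ?_) fun ω => ?_ <;>
    simp [halfCopyHom_consSeq, halfTurn_consSeq_false H, halfTurn_consSeq_true H]

lemma orderPreserving_x0 (H : IsGeneratingTriple x0 x1 c1) (a b : CSeq) :
    lexLt (x0 a) (x0 b) ↔ lexLt a b := by
  unfold IsGeneratingTriple at H
  rcases exists_consSeq a with ⟨a, rfl⟩ | ⟨a, rfl⟩ <;>
    [rcases exists_consSeq a with ⟨a, rfl⟩ | ⟨a, rfl⟩; skip] <;>
  rcases exists_consSeq b with ⟨b, rfl⟩ | ⟨b, rfl⟩ <;>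
    [rcases exists_consSeq b with ⟨b, rfl⟩ | ⟨b, rfl⟩; skip;
     rcases exists_consSeq b with ⟨b, rfl⟩ | ⟨b, rfl⟩; skip;
     rcases exists_consSeq b with ⟨b, rfl⟩ | ⟨b, rfl⟩; skip] <;>
  simp [H]

lemma orderPreserving_x1 (H : IsGeneratingTriple x0 x1 c1) (a b : CSeq) :
    lexLt (x1 a) (x1 b) ↔ lexLt a b := by
  rw [← halfCopyHom_x0 H]
  rcases exists_consSeq a with ⟨a, rfl⟩ | ⟨a, rfl⟩ <;>
  rcases exists_consSeq b with ⟨b, rfl⟩ | ⟨b, rfl⟩ <;>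
  simp [halfCopyHom_consSeq, orderPreserving_x0 H]

/-- The permutations preserving the cyclic order in both directions. -/
def cyclicSubgroup : Subgroup VPerm where
  carrier := {g | ∀ a b c, cyc3 (g a) (g b) (g c) ↔ cyc3 a b c}
  one_mem' := fun _ _ _ => Iff.rfl
  mul_mem' := fun hg hh a b c => (hg _ _ _).trans (hh a b c)
  inv_mem' := fun {g} hg a b c => by
    rw [← hg]
    simp only [← Equiv.Perm.mul_apply, mul_inv_cancel, Equiv.Perm.one_apply]

lemma c1_mem_cyclicSubgroup (H : IsGeneratingTriple x0 x1 c1) : c1 ∈ cyclicSubgroup := by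
  unfold IsGeneratingTriple at H
  have key : ∀ a, (∃ ω, a = consSeq false ω) ∨ (∃ ω, a = consSeq true (consSeq false ω)) ∨
      ∃ ω, a = consSeq true (consSeq true ω) := by
    intro a
    rcases exists_consSeq a with ⟨a, rfl⟩ | ⟨a, rfl⟩
    · exact Or.inl ⟨a, rfl⟩
    · rcases exists_consSeq a with ⟨a, rfl⟩ | ⟨a, rfl⟩
      exacts [Or.inr (Or.inl ⟨a, rfl⟩), Or.inr (Or.inr ⟨a, rfl⟩)]
  intro a b c
  rcases key a with ⟨a, rfl⟩ | ⟨a, rfl⟩ | ⟨a, rfl⟩ <;>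
  rcases key b with ⟨b, rfl⟩ | ⟨b, rfl⟩ | ⟨b, rfl⟩ <;>
  rcases key c with ⟨c, rfl⟩ | ⟨c, rfl⟩ | ⟨c, rfl⟩ <;>
  simp [H, cyc3]

lemma closure_le_cyclicSubgroup (H : IsGeneratingTriple x0 x1 c1) :
    Subgroup.closure {x0, x1, c1} ≤ cyclicSubgroup := by
  rw [Subgroup.closure_le]
  rintro g (rfl | rfl | rfl)
  · intro a b c
    simp only [cyc3, orderPreserving_x0 H]
  · intro a b c
    simp only [cyc3, orderPreserving_x1 H]
  · exact c1_mem_cyclicSubgroup H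

lemma x0_mem_closure : x0 ∈ Subgroup.closure {x0, x1, c1} := Subgroup.subset_closure (by simp)

lemma x1_mem_closure : x1 ∈ Subgroup.closure {x0, x1, c1} := Subgroup.subset_closure (by simp)

lemma c1_mem_closure : c1 ∈ Subgroup.closure {x0, x1, c1} := Subgroup.subset_closure (by simp)

lemma halfTurn_mem_closure : halfTurn x0 c1 ∈ Subgroup.closure {x0, x1, c1} :=
  mul_mem (inv_mem x0_mem_closure) (inv_mem c1_mem_closure)

/-- Every proper cylinder is carried onto the cylinder of `1` by prefix replacement. -/
lemma exists_mem_closure_app_eq (H : IsGeneratingTriple x0 x1 c1) (n : ℕ) :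
    ∀ u : List Bool, u.length = n → u ≠ [] →
      ∃ t ∈ Subgroup.closure {x0, x1, c1}, ∀ ω, t (app u ω) = consSeq true ω := by
  have H' := H
  unfold IsGeneratingTriple at H
  induction n with
  | zero => exact fun u hu hu' => absurd (List.length_eq_zero_iff.1 hu) hu'
  | succ n ih =>
    have step : ∀ {u v : List Bool} {s : VPerm}, v.length = n → v ≠ [] →
        s ∈ Subgroup.closure {x0, x1, c1} → (∀ ω, s (app u ω) = app v ω) →
        ∃ t ∈ Subgroup.closure {x0, x1, c1}, ∀ ω, t (app u ω) = consSeq true ω := by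
      intro u v s hv hv' hs hsv
      obtain ⟨t, ht, htv⟩ := ih v hv hv'
      exact ⟨t * s, mul_mem ht hs, fun ω => by rw [Equiv.Perm.mul_apply, hsv, htv]⟩
    intro u hu hu'
    rcases u with _ | ⟨a, _ | ⟨b, u⟩⟩
    · exact absurd rfl hu'
    · cases a
      · exact ⟨_, halfTurn_mem_closure, fun ω => by simp [halfTurn_consSeq_false H']⟩
      · exact ⟨1, one_mem _, fun ω => by simp⟩
    · have hlen : u.length + 1 = n := by simpa using hu
      cases a <;> cases b
      · exact step (v := false :: u) hlen (by simp) x0_mem_closure fun ω => by simp [H]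
      · exact step (v := false :: u) hlen (by simp)
          (mul_mem (inv_mem c1_mem_closure) x0_mem_closure) fun ω => by
            simp only [app_cons, Equiv.Perm.mul_apply, H]
      · exact step (v := false :: u) hlen (by simp) (inv_mem c1_mem_closure) fun ω => by
          simp only [app_cons, H]
      · exact step (v := true :: u) hlen (by simp) (inv_mem x0_mem_closure) fun ω => by
          simp only [app_cons, H]

/-! ### Generation -/

/-- The finite words on whose cylinders `g` does not act by prefix replacement. -/
def nonReplaced (g : VPerm) : Set (List Bool) := {u | ¬ PrefixReplaces g u}

lemma HasDepth.finite_nonReplaced {g : VPerm} {d : ℕ} (h : HasDepth g d) :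
    (nonReplaced g).Finite :=
  (List.finite_length_lt Bool d).subset fun u hu => by
    by_contra hd
    exact hu (h u (not_lt.1 hd))

lemma OrderPreserving.exists_replicate {g : VPerm} (hg : OrderPreserving g) {a : ℕ}
    (h : PrefixReplaces g (List.replicate a false)) :
    ∃ b, ∀ ω, g (app (List.replicate a false) ω) = app (List.replicate b false) ω := by
  obtain ⟨v, hv⟩ := h
  have h0 := hv fun _ => false
  rw [app_replicate_const, hg.apply_zero] at h0
  rw [eq_replicate_of_app_const h0.symm] at hv
  exact ⟨_, hv⟩

lemma app_replicate_succ' (b : Bool) (n : ℕ) (ω : CSeq) :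
    app (List.replicate (n + 1) b) ω = consSeq b (app (List.replicate n b) ω) := by
  rw [List.replicate_succ, app_cons]

/-- The rotation of the binary tree, on vertices, induced by the inverse of `x0`; it carries the
vertices `[]` and `1` to `[]` and `0`. -/
def rotateWord : List Bool → List Bool
  | [] => []
  | [true] => [false]
  | false :: u => false :: false :: u
  | true :: false :: u => false :: true :: u
  | true :: true :: u => true :: u

lemma rotateWord_injective : Function.Injective rotateWord := by
  rintro (_ | ⟨_ | _, _ | ⟨_ | _, u⟩⟩) (_ | ⟨_ | _, _ | ⟨_ | _, v⟩⟩) h <;>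
    simp_all [rotateWord]

/-- Any group containing `x0` and closed under copying to the cylinder of `1` contains every
order preserving element that replaces prefixes. -/
lemma mem_of_orderPreserving (H : IsGeneratingTriple x0 x1 c1)
    (hD : ∀ s ∈ ({x0, x1, c1} : Set VPerm), HasDepth s 3 ∧ HasDepth s⁻¹ 3)
    {P : Subgroup VPerm} (hx0 : x0 ∈ P) (hP : ∀ f ∈ P, halfCopyHom true f ∈ P) (n : ℕ) :
    ∀ g : VPerm, OrderPreserving g → (∃ d, HasDepth g d) → (nonReplaced g).ncard ≤ n → g ∈ P := by
  have H' := H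
  unfold IsGeneratingTriple at H
  induction n with
  | zero =>
    rintro g - ⟨d, hd⟩ hn
    have h0 : nonReplaced g = ∅ := (Set.ncard_eq_zero hd.finite_nonReplaced).1 (by omega)
    have h1 : PrefixReplaces g [] := by
      by_contra h
      have : [] ∈ nonReplaced g := h
      simp [h0] at this
    exact eq_one_of_prefixReplaces_nil h1 ▸ one_mem P
  | succ n ih =>
    -- the range side: `g` replaces `0` with `0 ^ b`
    have range : ∀ b : ℕ, ∀ g : VPerm, OrderPreserving g → (∃ d, HasDepth g d) →
        (nonReplaced g).ncard ≤ n + 1 →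
        (∀ ω, g (consSeq false ω) = app (List.replicate b false) ω) → g ∈ P := by
      intro b
      induction b with
      | zero =>
        intro g _ _ _ hb
        have h1 := g.injective (hb (g (consSeq true fun _ => false)))
        simp at h1
      | succ b ihb =>
        rintro g hg ⟨d, hd⟩ hn hb
        by_cases h1 : PrefixReplaces g []
        · exact eq_one_of_prefixReplaces_nil h1 ▸ one_mem P
        cases b with
        | zero =>
          obtain ⟨f, rfl⟩ := exists_eq_halfCopyHom (b := true) (g := g) (by simpa using hb)
          refine hP f (ih f ?_ ⟨d, hd.of_halfCopyHom⟩ ?_)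
          · intro a b hab
            simpa [halfCopyHom_consSeq, hab] using hg (consSeq true a) (consSeq true b)
          · have hsub : (fun u => true :: u) '' nonReplaced f ⊆
                nonReplaced (halfCopyHom true f) \ {[]} := by
              rintro _ ⟨u, hu, rfl⟩
              exact ⟨fun h => hu (prefixReplaces_of_halfCopyHom h), by simp⟩
            have h2 := Set.ncard_le_ncard hsub hd.finite_nonReplaced.sdiff
            rw [Set.ncard_image_of_injective _ (List.cons_injective)] at h2
            have h3 := Set.ncard_sdiff_singleton_add_one (a := [])
              (s := nonReplaced (halfCopyHom true f)) h1 hd.finite_nonReplaced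
            omega
        | succ b =>
          have hk : x0 * g ∈ P := by
            refine ihb (x0 * g) ?_ ⟨_, (hD x0 (by simp)).1.mul hd⟩ ?_ fun ω => ?_
            · exact fun a b hab => (orderPreserving_x0 H' _ _).2 (hg a b hab)
            · refine (Set.ncard_le_ncard ?_ hd.finite_nonReplaced).trans hn
              intro u hu h
              apply hu
              obtain ⟨v, hv⟩ := h
              rcases v with _ | ⟨_ | _, _ | ⟨_ | _, v⟩⟩
              · have hu' : u = [] := nil_of_forall_apply_eq_app (g := g⁻¹) fun ω => by
                  rw [Equiv.Perm.inv_eq_iff_eq, hv, app_nil]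
                exact absurd ⟨[], by simpa [hu'] using hv⟩ h1
              · have hu' : u ++ List.replicate (b + 1) false = [false] :=
                  word_eq_of_app_eq fun ω => g.injective (by
                    rw [app_append, hv, app_cons, app_nil, ← app_replicate_succ', ← hb,
                      app_cons, app_nil])
                have hu'' : u = [] := by
                  have := congrArg List.length hu'
                  exact List.length_eq_zero_iff.1 (by simp at this; omega)
                exact absurd ⟨[false], by simpa [hu''] using hv⟩ h1
              · exact ⟨false :: v, fun ω => by simp [hv, H]⟩
              · exact ⟨true :: false :: v, fun ω => by simp [hv, H]⟩
              · exact ⟨[true, true], fun ω => by simp [hv, H]⟩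
              · exact ⟨true :: true :: false :: v, fun ω => by simp [hv, H]⟩
              · exact ⟨true :: true :: true :: v, fun ω => by simp [hv, H]⟩
            · rw [Equiv.Perm.mul_apply, hb, app_replicate_succ', app_replicate_succ', (H _).1]
          simpa using mul_mem (inv_mem hx0) hk
    have domain : ∀ a : ℕ, ∀ g : VPerm, OrderPreserving g → (∃ d, HasDepth g d) →
        (nonReplaced g).ncard ≤ n + 1 → PrefixReplaces g (List.replicate (a + 1) false) →
        g ∈ P := by
      intro a
      induction a with
      | zero =>
        intro g hg hd hn ha
        obtain ⟨b, hb⟩ := hg.exists_replicate ha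
        exact range b g hg hd hn (by simpa using hb)
      | succ a iha =>
        rintro g hg ⟨d, hd⟩ hn ha
        by_cases h0 : PrefixReplaces g (List.replicate 1 false)
        · obtain ⟨b, hb⟩ := hg.exists_replicate h0
          exact range b g hg ⟨d, hd⟩ hn (by simpa using hb)
        have hk : g * x0⁻¹ ∈ P := by
          refine iha (g * x0⁻¹) ?_ ⟨_, hd.mul (hD x0 (by simp)).2⟩ ?_ ?_
          · refine hg.mul fun a b hab => ?_
            rw [← orderPreserving_x0 H']
            simpa using hab
          · refine (Set.ncard_le_ncard_of_injOn (t := nonReplaced g) rotateWord ?_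
              rotateWord_injective.injOn hd.finite_nonReplaced).trans hn
            intro u hu h
            apply hu
            rcases u with _ | ⟨_ | _, _ | ⟨_ | _, u⟩⟩
            · exact absurd (h.append [false]) h0
            all_goals
              obtain ⟨v, hv⟩ := h
              simp only [rotateWord, app_cons, app_nil] at hv
            · exact ⟨v, fun ω => by simp only [Equiv.Perm.mul_apply, app_cons, app_nil, H, hv]⟩
            · exact ⟨v, fun ω => by simp only [Equiv.Perm.mul_apply, app_cons, H, hv]⟩
            · exact ⟨v, fun ω => by simp only [Equiv.Perm.mul_apply, app_cons, H, hv]⟩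
            · exact absurd ⟨v, by simpa using hv⟩ h0
            · exact ⟨v, fun ω => by simp only [Equiv.Perm.mul_apply, app_cons, H, hv]⟩
            · exact ⟨v, fun ω => by simp only [Equiv.Perm.mul_apply, app_cons, H, hv]⟩
          · obtain ⟨v, hv⟩ := ha
            refine ⟨v, fun ω => ?_⟩
            rw [← hv, Equiv.Perm.mul_apply, app_replicate_succ', app_replicate_succ',
              (H _).2.2.2.1]
            simp only [app_replicate_succ']
        simpa using mul_mem hk hx0
    rintro g hg ⟨d, hd⟩ hn
    exact domain d g hg ⟨d, hd⟩ hn (hd _ (by simp))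

lemma mem_closure_of_inT (H : IsGeneratingTriple x0 x1 c1)
    (hD : ∀ s ∈ ({x0, x1, c1} : Set VPerm), HasDepth s 3 ∧ HasDepth s⁻¹ 3)
    {g : VPerm} (hg : InT g) : g ∈ Subgroup.closure {x0, x1, c1} := by
  have hdepth : ∀ t ∈ Subgroup.closure {x0, x1, c1}, ∃ d, HasDepth t d := by
    intro t ht
    induction ht using Subgroup.closure_induction'' with
    | mem s hs => exact ⟨3, (hD s hs).1⟩
    | inv_mem s hs => exact ⟨3, (hD s hs).2⟩
    | one => exact ⟨0, HasDepth.one⟩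
    | mul s t _ _ hs ht =>
      obtain ⟨d, hd⟩ := hs
      obtain ⟨e, he⟩ := ht
      exact ⟨_, hd.mul he⟩
  obtain ⟨⟨T, hT⟩, hcyc⟩ := hg
  obtain ⟨⟨u, v⟩, ⟨huv, -⟩, -⟩ := hT.1 fun _ => false
  obtain ⟨s, hs, hsu⟩ := exists_mem_closure_app_eq H _ (u ++ [true]) rfl (by simp)
  obtain ⟨t, ht, htv⟩ := exists_mem_closure_app_eq H _ (v ++ [true]) rfl (by simp)
  have hfix : ∀ ω, (t * g * s⁻¹) (consSeq true ω) = consSeq true ω := by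
    intro ω
    have h1 : s⁻¹ (consSeq true ω) = app (u ++ [true]) ω := by
      rw [Equiv.Perm.inv_eq_iff_eq, hsu]
    have h2 := hT.2.2 _ huv (app [true] ω)
    rw [Equiv.Perm.mul_apply, Equiv.Perm.mul_apply, h1, app_append, h2, ← htv, app_append]
  obtain ⟨f, hf⟩ := exists_eq_halfCopyHom (b := false) hfix
  have hcyc' : ∀ a b c, cyc3 a b c →
      cyc3 (halfCopyHom false f a) (halfCopyHom false f b) (halfCopyHom false f c) := by
    intro a b c h
    rw [← hf]
    refine (closure_le_cyclicSubgroup H ht _ _ _).2 (hcyc _ _ _ ?_)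
    exact (closure_le_cyclicSubgroup H (inv_mem hs) _ _ _).2 h
  have hford : OrderPreserving f := by
    intro a b hab
    have := hcyc' (consSeq false a) (consSeq false b) (consSeq true a)
    simpa [cyc3, halfCopyHom_consSeq, hab] using this
  obtain ⟨d, hd⟩ := InV.exists_hasDepth ⟨T, hT⟩
  obtain ⟨ds, hds⟩ := hdepth s⁻¹ (inv_mem hs)
  obtain ⟨dt, hdt⟩ := hdepth t ht
  have hfd := (hdt.mul hd).mul hds
  rw [hf] at hfd
  have hf1 : f ∈ (Subgroup.closure {x0, x1, c1}).comap (halfCopyHom true) := by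
    refine mem_of_orderPreserving H hD ?_ (fun k hk => ?_) _ f hford ⟨_, hfd.of_halfCopyHom⟩ le_rfl
    · rw [Subgroup.mem_comap, halfCopyHom_x0 H]
      exact x1_mem_closure
    · rw [Subgroup.mem_comap, halfCopyHom_halfCopyHom H]
      exact mul_mem (mul_mem x0_mem_closure hk) (inv_mem x0_mem_closure)
  have hk : t * g * s⁻¹ ∈ Subgroup.closure {x0, x1, c1} := by
    rw [hf, halfCopyHom_false H]
    exact mul_mem (mul_mem (inv_mem halfTurn_mem_closure) hf1) halfTurn_mem_closure
  have := mul_mem (mul_mem (inv_mem ht) hk) hs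
  simpa [mul_assoc] using this

end Generators

/-! ### Word length -/

section WordLength

variable {S : Set VPerm}

lemma wlen_le_length {l : List VPerm} (hl : ∀ x ∈ l, x ∈ S ∨ x⁻¹ ∈ S) :
    wlen S l.prod ≤ l.length := Nat.sInf_le ⟨l, rfl, hl, rfl⟩

lemma exists_length_eq_wlen {g : VPerm} (hg : g ∈ Subgroup.closure S) :
    ∃ l : List VPerm, l.length = wlen S g ∧ (∀ x ∈ l, x ∈ S ∨ x⁻¹ ∈ S) ∧ l.prod = g := by
  rw [← Subgroup.mem_toSubmonoid, Subgroup.closure_toSubmonoid] at hg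
  obtain ⟨l, hl, rfl⟩ := Submonoid.exists_list_of_mem_closure hg
  exact Nat.sInf_mem (s := {n | ∃ l' : List VPerm, l'.length = n ∧
    (∀ x ∈ l', x ∈ S ∨ x⁻¹ ∈ S) ∧ l'.prod = l.prod}) ⟨_, l, rfl, hl, rfl⟩

lemma mem_closure_of_letter {s : VPerm} (hs : s ∈ S ∨ s⁻¹ ∈ S) : s ∈ Subgroup.closure S :=
  hs.elim (fun h => Subgroup.subset_closure h) fun h => inv_mem_iff.1 (Subgroup.subset_closure h)

lemma wlen_letter_le {s : VPerm} (hs : s ∈ S ∨ s⁻¹ ∈ S) : wlen S s ≤ 1 := by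
  simpa using wlen_le_length (l := [s]) (by simpa using hs)

lemma wlen_mul_le {g h : VPerm} (hg : g ∈ Subgroup.closure S) (hh : h ∈ Subgroup.closure S) :
    wlen S (g * h) ≤ wlen S g + wlen S h := by
  obtain ⟨l, hl, hlS, rfl⟩ := exists_length_eq_wlen hg
  obtain ⟨k, hk, hkS, rfl⟩ := exists_length_eq_wlen hh
  rw [← hl, ← hk, ← List.prod_append, ← List.length_append]
  exact wlen_le_length fun x hx => (List.mem_append.1 hx).elim (hlS x) (hkS x)

lemma wlen_inv_le {g : VPerm} (hg : g ∈ Subgroup.closure S) : wlen S g⁻¹ ≤ wlen S g := by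
  obtain ⟨l, hl, hlS, rfl⟩ := exists_length_eq_wlen hg
  rw [← hl, List.prod_inv_reverse]
  refine (wlen_le_length fun x hx => ?_).trans (by simp)
  obtain ⟨y, hy, rfl⟩ := List.mem_map.1 (List.mem_reverse.1 hx)
  rw [inv_inv]
  exact (hlS y hy).symm

lemma wlen_inv {g : VPerm} (hg : g ∈ Subgroup.closure S) : wlen S g⁻¹ = wlen S g :=
  (wlen_inv_le hg).antisymm (by simpa using wlen_inv_le (inv_mem hg))

lemma wlen_le_wlen_mul_add {g t : VPerm} (ht : t ∈ Subgroup.closure S)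
    (hg : g ∈ Subgroup.closure S) : wlen S g ≤ wlen S (t * g) + wlen S t := by
  have h := wlen_mul_le (inv_mem ht) (mul_mem ht hg)
  rw [inv_mul_cancel_left, wlen_inv ht] at h
  omega

lemma wlen_pos {g : VPerm} (hg : g ∈ Subgroup.closure S) (h1 : g ≠ 1) : 0 < wlen S g := by
  obtain ⟨l, hl, -, rfl⟩ := exists_length_eq_wlen hg
  rw [← hl, List.length_pos_iff]
  rintro rfl
  exact h1 rfl

lemma hasDepth_wlen {d : ℕ} (hS : ∀ s ∈ S, HasDepth s d ∧ HasDepth s⁻¹ d) {g : VPerm}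
    (hg : g ∈ Subgroup.closure S) : HasDepth g (d * wlen S g) := by
  obtain ⟨l, hl, hlS, rfl⟩ := exists_length_eq_wlen hg
  rw [← hl]
  clear hg hl
  induction l with
  | nil => exact HasDepth.one
  | cons s l ih =>
    have hs : HasDepth s d := by
      rcases hlS s (by simp) with h | h
      · exact (hS _ h).1
      · simpa using (hS _ h).2
    have := hs.mul (ih fun x hx => hlS x (List.mem_cons_of_mem _ hx))
    rwa [List.prod_cons, List.length_cons, Nat.mul_succ, add_comm (d * _)]

lemma length_lt_of_not_prefixReplaces {d : ℕ} (hS : ∀ s ∈ S, HasDepth s d ∧ HasDepth s⁻¹ d)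
    {g : VPerm} (hg : g ∈ Subgroup.closure S) {v : List Bool} (hv : ¬ PrefixReplaces g⁻¹ v) :
    v.length < d * wlen S g := by
  by_contra h
  refine hv (hasDepth_wlen hS (inv_mem hg) v ?_)
  rw [wlen_inv hg]
  omega

/-! ### Paths far from the identity -/

/-- `FarPath S m a n b`: left multiplication by at most `n` letters leads from `a` to `b` through
elements `x` with `m ≤ 4 * wlen S x`. -/
inductive FarPath (S : Set VPerm) (m : ℕ) (a : VPerm) : ℕ → VPerm → Prop
  | refl : m ≤ 4 * wlen S a → FarPath S m a 0 a
  | idle {n : ℕ} {b : VPerm} : FarPath S m a n b → FarPath S m a (n + 1) b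
  | step {n : ℕ} {b s : VPerm} : FarPath S m a n b → (s ∈ S ∨ s⁻¹ ∈ S) →
      m ≤ 4 * wlen S (s * b) → FarPath S m a (n + 1) (s * b)

namespace FarPath

variable {m n k : ℕ} {a b c : VPerm}

lemma mono (h : FarPath S m a n b) (hn : n ≤ k) : FarPath S m a k b := by
  induction k, hn using Nat.le_induction with
  | base => exact h
  | succ k _ ih => exact ih.idle

lemma le_right (h : FarPath S m a n b) : m ≤ 4 * wlen S b := by
  induction h with
  | refl h => exact h
  | idle _ ih => exact ih
  | step _ _ h _ => exact h

lemma trans (h : FarPath S m a n b) (h' : FarPath S m b k c) : FarPath S m a (n + k) c := by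
  induction h' with
  | refl _ => exact h
  | idle _ ih => exact ih.idle
  | step _ hs hm ih => exact ih.step hs hm

lemma symm (h : FarPath S m a n b) : FarPath S m b n a := by
  induction h with
  | refl h => exact .refl h
  | idle _ ih => exact ih.idle
  | @step n b s h hs hm ih =>
    have h1 : FarPath S m (s * b) (0 + 1) (s⁻¹ * (s * b)) :=
      (FarPath.refl hm).step (by simpa using hs.symm) (by simpa using h.le_right)
    rw [inv_mul_cancel_left] at h1
    exact (h1.trans ih).mono (by omega)

lemma wlen_le (h : FarPath S m a n b) (ha : a ∈ Subgroup.closure S) :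
    b ∈ Subgroup.closure S ∧ wlen S b ≤ wlen S a + n := by
  induction h with
  | refl _ => exact ⟨ha, le_rfl⟩
  | idle _ ih => exact ⟨ih.1, by omega⟩
  | step _ hs _ ih =>
    have h1 := mem_closure_of_letter hs
    have h2 := wlen_mul_le h1 ih.1
    have h3 := wlen_letter_le hs
    exact ⟨mul_mem h1 ih.1, by omega⟩

lemma mul_left {t : VPerm} (ha : a ∈ Subgroup.closure S) (ht : t ∈ Subgroup.closure S)
    (h : m + 4 * wlen S t ≤ 4 * wlen S a) : FarPath S m a (wlen S t) (t * a) := by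
  obtain ⟨l, hl, hlS, rfl⟩ := exists_length_eq_wlen ht
  rw [← hl] at h ⊢
  clear hl ht
  induction l with
  | nil => exact .refl (by simpa using h)
  | cons s l ih =>
    have hl : ∀ x ∈ l, x ∈ S ∨ x⁻¹ ∈ S := fun x hx => hlS x (List.mem_cons_of_mem _ hx)
    rw [List.length_cons] at h
    have h1 := ih hl (by omega)
    have hs := hlS s (by simp)
    have h2 := (h1.wlen_le ha).1
    have h3 := mul_mem (mem_closure_of_letter hs) h2
    have hmem : (s :: l).prod ∈ Subgroup.closure S := by
      simpa [mul_assoc] using mul_mem h3 (inv_mem ha)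
    have h4 := wlen_le_wlen_mul_add hmem ha
    have h5 := wlen_le_length hlS
    rw [List.length_cons] at h5
    rw [List.prod_cons, mul_assoc] at *
    exact h1.step hs (by omega)

lemma pow_mul {s : VPerm} (hs : s ∈ S) (h : ∀ i ≤ k, m ≤ 4 * wlen S (s ^ i * a)) :
    FarPath S m a k (s ^ k * a) := by
  induction k with
  | zero => simpa using FarPath.refl (by simpa using h 0 le_rfl)
  | succ k ih =>
    have h1 := h (k + 1) le_rfl
    rw [pow_succ', mul_assoc] at h1 ⊢
    exact (ih fun i hi => h i (by omega)).step (.inl hs) h1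

lemma exists_word (h : FarPath S m a n b) :
    ∃ w : List VPerm, (∀ x ∈ w, x ∈ S ∨ x⁻¹ ∈ S) ∧ w.length ≤ n ∧ wordEval a w = b ∧
      ∀ w' : List VPerm, w' <+: w → m ≤ 4 * wlen S (wordEval a w') := by
  induction h with
  | refl h => exact ⟨[], by simp, le_rfl, rfl, fun w' hw' => by
      rw [List.prefix_nil.1 hw']; exact h⟩
  | idle _ ih =>
    obtain ⟨w, h1, h2, h3, h4⟩ := ih
    exact ⟨w, h1, by omega, h3, h4⟩
  | @step n b s _ hs hm ih =>
    obtain ⟨w, h1, h2, h3, h4⟩ := ih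
    have h5 : wordEval a (w ++ [s]) = s * b := by
      rw [wordEval, List.foldl_append]
      change (wordEval a w).trans s = s * b
      rw [h3]
      rfl
    refine ⟨w ++ [s], ?_, by simpa using h2, h5, fun w' hw' => ?_⟩
    · intro x hx
      rcases List.mem_append.1 hx with hx | hx
      · exact h1 x hx
      · rw [List.mem_singleton.1 hx]
        exact hs
    · rcases List.prefix_concat_iff.1 hw' with rfl | hw'
      · rw [h5]
        exact hm
      · exact h4 w' hw'

end FarPath

end WordLength

lemma not_prefixReplaces_inv {g : VPerm} {u v : List Bool}
    (h1 : ∀ ω, g (app u (consSeq true ω)) = app v (consSeq true ω))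
    (h0 : ∀ ω, g (app u (consSeq false (consSeq true ω))) = app v (consSeq false ω)) :
    ¬ PrefixReplaces g⁻¹ v := by
  rintro ⟨w, hw⟩
  simp only [Equiv.Perm.inv_eq_iff_eq] at hw
  have h2 : w ++ [true] = u ++ [true] := word_eq_of_app_eq fun ω => g.injective (by
    simp [h1, ← hw])
  have h3 : w ++ [false] = u ++ [false, true] := word_eq_of_app_eq fun ω => g.injective (by
    simp [h0, ← hw])
  have h4 := congrArg List.length h2
  have h5 := congrArg List.length h3
  simp at h4 h5
  omega

lemma not_prefixReplaces_inv_mul {s g : VPerm} {v v' : List Bool}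
    (h : ¬ PrefixReplaces g⁻¹ v) (hs : ∀ ω, s (app v ω) = app v' ω) :
    ¬ PrefixReplaces (s * g)⁻¹ v' := by
  rintro ⟨w, hw⟩
  refine h ⟨w, fun ω => ?_⟩
  rw [← hw, ← hs, mul_inv_rev, Equiv.Perm.mul_apply, ← Equiv.Perm.mul_apply s⁻¹, inv_mul_cancel,
    Equiv.Perm.one_apply]

/-! ### Connecting elements far from the identity -/

section Connecting

variable {x0 x1 c1 : VPerm}

lemma x1_pow_consSeq (H : IsGeneratingTriple x0 x1 c1) (k : ℕ) (b : Bool) (ω : CSeq) :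
    (x1 ^ k) (consSeq b ω) = consSeq b (if b = true then (x0 ^ k) ω else ω) := by
  rw [← halfCopyHom_x0 H, ← map_pow, halfCopyHom_consSeq]
  cases b <;> simp

lemma x0_pow_consSeq_true (H : IsGeneratingTriple x0 x1 c1) (k : ℕ) (ω : CSeq) :
    (x0 ^ k) (consSeq true ω) = app (List.replicate k true) (consSeq true ω) := by
  unfold IsGeneratingTriple at H
  induction k with
  | zero => simp
  | succ k ih =>
    rw [pow_succ', Equiv.Perm.mul_apply, ih, List.replicate_succ, app_cons]
    cases k <;> simp [List.replicate_succ, H]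

lemma x0_pow_consSeq_false_true (H : IsGeneratingTriple x0 x1 c1) {k : ℕ} (hk : 1 ≤ k)
    (ω : CSeq) :
    (x0 ^ k) (consSeq false (consSeq true ω)) =
      app (List.replicate k true) (consSeq false ω) := by
  obtain ⟨k, rfl⟩ := Nat.exists_eq_add_of_le' hk
  have h := x0_pow_consSeq_true H k (consSeq false ω)
  unfold IsGeneratingTriple at H
  rw [pow_succ, Equiv.Perm.mul_apply, (H ω).2.1, h, app_replicate_succ]

lemma x0_pow_app_replicate_false (H : IsGeneratingTriple x0 x1 c1) (k : ℕ) (ω : CSeq) :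
    (x0 ^ k) (app (List.replicate (k + 1) false) ω) = consSeq false ω := by
  unfold IsGeneratingTriple at H
  induction k with
  | zero => simp
  | succ k ih =>
    rw [pow_succ, Equiv.Perm.mul_apply, app_replicate_succ', app_replicate_succ', (H _).1,
      ← app_replicate_succ', ih]

/-- The conjugate of `x1 ^ k` by `a`. -/
def conjPow (x1 a : VPerm) (k : ℕ) : VPerm := a⁻¹ * (x1 ^ k * a)

lemma conjPow_app (H : IsGeneratingTriple x0 x1 c1) {a : VPerm} {u : List Bool}
    (hu : ∀ ω, a (app u ω) = consSeq true ω) (k : ℕ) (ω : CSeq) :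
    conjPow x1 a k (app u ω) = app u ((x0 ^ k) ω) := by
  rw [conjPow, Equiv.Perm.mul_apply, Equiv.Perm.mul_apply, hu, x1_pow_consSeq H, if_pos rfl,
    Equiv.Perm.inv_eq_iff_eq, hu]

lemma conjPow_eq_self (H : IsGeneratingTriple x0 x1 c1) {a : VPerm} {u : List Bool}
    (hu : ∀ ω, a (app u ω) = consSeq true ω) (k : ℕ) {ω : CSeq} (hω : ∀ η, ω ≠ app u η) :
    conjPow x1 a k ω = ω := by
  rw [conjPow, Equiv.Perm.mul_apply, Equiv.Perm.mul_apply, Equiv.Perm.inv_eq_iff_eq]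
  rcases exists_consSeq (a ω) with ⟨η, h⟩ | ⟨η, h⟩
  · rw [h, x1_pow_consSeq H, if_neg (by simp)]
  · exact absurd (a.injective (h.trans (hu η).symm)) (hω η)

lemma app_cons_ne_app_cons_not (c : Bool) (u w : List Bool) (ω η : CSeq) :
    app (c :: u) ω ≠ app ((!c) :: w) η := by
  cases c <;> simp

lemma conjPow_comm (H : IsGeneratingTriple x0 x1 c1) {a b : VPerm} {c : Bool} {u w : List Bool}
    (hu : ∀ ω, a (app (c :: u) ω) = consSeq true ω)
    (hw : ∀ ω, b (app ((!c) :: w) ω) = consSeq true ω) (k : ℕ) :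
    conjPow x1 a k * conjPow x1 b k = conjPow x1 b k * conjPow x1 a k := by
  refine Equiv.ext fun ω => ?_
  rw [Equiv.Perm.mul_apply, Equiv.Perm.mul_apply]
  by_cases h : ∃ η, ω = app (c :: u) η
  · obtain ⟨η, rfl⟩ := h
    rw [conjPow_eq_self H hw _ (app_cons_ne_app_cons_not c u w η), conjPow_app H hu,
      conjPow_eq_self H hw _ (app_cons_ne_app_cons_not c u w _)]
  · push Not at h
    rw [conjPow_eq_self H hu _ h]
    by_cases h' : ∃ η, ω = app ((!c) :: w) η
    · obtain ⟨η, rfl⟩ := h'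
      rw [conjPow_app H hw, conjPow_eq_self H hu]
      exact fun ξ => (app_cons_ne_app_cons_not c u w ξ _).symm
    · push Not at h'
      rw [conjPow_eq_self H hw _ h', conjPow_eq_self H hu _ h]

lemma conjPow_mem_closure {a : VPerm} (ha : a ∈ Subgroup.closure {x0, x1, c1}) (k : ℕ) :
    conjPow x1 a k ∈ Subgroup.closure {x0, x1, c1} :=
  mul_mem (inv_mem ha) (mul_mem (pow_mem x1_mem_closure k) ha)

lemma not_prefixReplaces_x1_pow_mul_inv (H : IsGeneratingTriple x0 x1 c1) {a : VPerm}
    {u : List Bool} (hu : ∀ ω, a (app u ω) = consSeq true ω) {k : ℕ} (hk : 1 ≤ k) :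
    ¬ PrefixReplaces (x1 ^ k * a)⁻¹ (List.replicate (k + 1) true) := by
  refine not_prefixReplaces_inv (u := u) (fun ω => ?_) fun ω => ?_
  · rw [Equiv.Perm.mul_apply, hu, x1_pow_consSeq H, if_pos rfl, x0_pow_consSeq_true H,
      app_replicate_succ']
  · rw [Equiv.Perm.mul_apply, hu, x1_pow_consSeq H, if_pos rfl, x0_pow_consSeq_false_true H hk,
      app_replicate_succ']

lemma lt_wlen_x1_pow_mul (H : IsGeneratingTriple x0 x1 c1)
    (hD : ∀ s ∈ ({x0, x1, c1} : Set VPerm), HasDepth s 3 ∧ HasDepth s⁻¹ 3) {a : VPerm}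
    (ha : a ∈ Subgroup.closure {x0, x1, c1}) {u : List Bool}
    (hu : ∀ ω, a (app u ω) = consSeq true ω) {k : ℕ} (hk : 1 ≤ k) :
    k + 1 < 3 * wlen {x0, x1, c1} (x1 ^ k * a) := by
  simpa using length_lt_of_not_prefixReplaces hD (mul_mem (pow_mem x1_mem_closure k) ha)
    (not_prefixReplaces_x1_pow_mul_inv H hu hk)

lemma lt_wlen_conjPow_mul_conjPow (H : IsGeneratingTriple x0 x1 c1)
    (hD : ∀ s ∈ ({x0, x1, c1} : Set VPerm), HasDepth s 3 ∧ HasDepth s⁻¹ 3) {a b : VPerm}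
    (ha : a ∈ Subgroup.closure {x0, x1, c1}) (hb : b ∈ Subgroup.closure {x0, x1, c1})
    {c : Bool} {u w : List Bool} (hu : ∀ ω, a (app (c :: u) ω) = consSeq true ω)
    (hw : ∀ ω, b (app ((!c) :: w) ω) = consSeq true ω) (i : ℕ) {k : ℕ} (hk : 1 ≤ k) :
    k < 3 * wlen {x0, x1, c1} (conjPow x1 b i * conjPow x1 a k) := by
  have h (ω : CSeq) : (conjPow x1 b i * conjPow x1 a k) (app (c :: u) ω) =
      app (c :: u) ((x0 ^ k) ω) := by
    rw [Equiv.Perm.mul_apply, conjPow_app H hu,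
      conjPow_eq_self H hw _ (app_cons_ne_app_cons_not c u w _)]
  have h1 : ¬ PrefixReplaces (conjPow x1 b i * conjPow x1 a k)⁻¹
      ((c :: u) ++ List.replicate k true) :=
    not_prefixReplaces_inv (u := c :: u)
      (fun ω => by rw [h, x0_pow_consSeq_true H, app_append])
      fun ω => by rw [h, x0_pow_consSeq_false_true H hk, app_append]
  have h2 := length_lt_of_not_prefixReplaces hD
    (mul_mem (conjPow_mem_closure hb i) (conjPow_mem_closure ha k)) h1
  simp at h2
  omega

lemma FarPath.conjPow_mul (H : IsGeneratingTriple x0 x1 c1)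
    (hD : ∀ s ∈ ({x0, x1, c1} : Set VPerm), HasDepth s 3 ∧ HasDepth s⁻¹ 3) {a b : VPerm}
    (ha : a ∈ Subgroup.closure {x0, x1, c1}) (hb : b ∈ Subgroup.closure {x0, x1, c1})
    {c : Bool} {u w : List Bool} (hu : ∀ ω, a (app (c :: u) ω) = consSeq true ω)
    (hw : ∀ ω, b (app ((!c) :: w) ω) = consSeq true ω) {m k : ℕ} (hk : 1 ≤ k)
    (hmk : 3 * m + 24 * wlen {x0, x1, c1} b ≤ 4 * k) :
    FarPath {x0, x1, c1} m (conjPow x1 a k) (2 * wlen {x0, x1, c1} b + k)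
      (conjPow x1 b k * conjPow x1 a k) := by
  have hκ := conjPow_mem_closure ha k
  have hfar (i : ℕ) : m + 4 * wlen {x0, x1, c1} b ≤
      4 * wlen {x0, x1, c1} (x1 ^ i * (b * conjPow x1 a k)) := by
    have h1 := lt_wlen_conjPow_mul_conjPow H hD ha hb hu hw i hk
    have h2 := wlen_mul_le (inv_mem hb) (mul_mem (pow_mem x1_mem_closure i) (mul_mem hb hκ))
    rw [wlen_inv hb] at h2
    have h3 : b⁻¹ * (x1 ^ i * (b * conjPow x1 a k)) = conjPow x1 b i * conjPow x1 a k := by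
      simp only [conjPow, mul_assoc]
    rw [h3] at h2
    omega
  have h0 : m + 4 * wlen {x0, x1, c1} b ≤ 4 * wlen {x0, x1, c1} (conjPow x1 a k) := by
    have h1 := lt_wlen_conjPow_mul_conjPow H hD ha hb hu hw 0 hk
    have h2 : conjPow x1 b 0 = 1 := by simp [conjPow]
    rw [h2, one_mul] at h1
    omega
  have p1 := FarPath.mul_left hκ hb h0
  have p2 := FarPath.pow_mul (S := {x0, x1, c1}) (m := m) (k := k) (s := x1)
    (a := b * conjPow x1 a k) (by simp) fun i _ => by have := hfar i; omega
  have p3 := FarPath.mul_left (mul_mem (pow_mem x1_mem_closure k) (mul_mem hb hκ)) (inv_mem hb)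
    (m := m) (by rw [wlen_inv hb]; exact hfar k)
  rw [wlen_inv hb] at p3
  have h3 : b⁻¹ * (x1 ^ k * (b * conjPow x1 a k)) = conjPow x1 b k * conjPow x1 a k := by
    simp only [conjPow, mul_assoc]
  rw [h3] at p3
  exact ((p1.trans p2).trans p3).mono (by omega)

lemma FarPath.conjPow_conjPow (H : IsGeneratingTriple x0 x1 c1)
    (hD : ∀ s ∈ ({x0, x1, c1} : Set VPerm), HasDepth s 3 ∧ HasDepth s⁻¹ 3) {a b : VPerm}
    (ha : a ∈ Subgroup.closure {x0, x1, c1}) (hb : b ∈ Subgroup.closure {x0, x1, c1})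
    {c : Bool} {u w : List Bool} (hu : ∀ ω, a (app (c :: u) ω) = consSeq true ω)
    (hw : ∀ ω, b (app ((!c) :: w) ω) = consSeq true ω) {m k : ℕ} (hk : 1 ≤ k)
    (hka : 3 * m + 24 * wlen {x0, x1, c1} a ≤ 4 * k)
    (hkb : 3 * m + 24 * wlen {x0, x1, c1} b ≤ 4 * k) :
    FarPath {x0, x1, c1} m (conjPow x1 a k)
      (2 * wlen {x0, x1, c1} a + 2 * wlen {x0, x1, c1} b + 2 * k) (conjPow x1 b k) := by
  have p1 := FarPath.conjPow_mul H hD ha hb hu hw hk hkb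
  have p2 := FarPath.conjPow_mul H hD hb ha (c := !c) (u := w) (w := u) hw
    (by simpa using hu) hk hka
  rw [conjPow_comm H hu hw] at p2
  exact (p1.trans p2.symm).mono (by omega)

lemma exists_farPath_apply_eq_consSeq_true (H : IsGeneratingTriple x0 x1 c1)
    (hD : ∀ s ∈ ({x0, x1, c1} : Set VPerm), HasDepth s 3 ∧ HasDepth s⁻¹ 3) {g : VPerm}
    (hg : g ∈ Subgroup.closure {x0, x1, c1}) {m : ℕ} (hm : m ≤ wlen {x0, x1, c1} g)
    (h1 : 1 ≤ wlen {x0, x1, c1} g) :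
    ∃ a ∈ Subgroup.closure {x0, x1, c1}, ∃ u, (∀ ω, a (app u ω) = consSeq true ω) ∧
      wlen {x0, x1, c1} a ≤ 11 * wlen {x0, x1, c1} g ∧
      FarPath {x0, x1, c1} m g (10 * wlen {x0, x1, c1} g) a ∧
      ∀ k, m ≤ 4 * wlen {x0, x1, c1} (x1 ^ k * a) := by
  set n := wlen {x0, x1, c1} g with hn
  have hpow {s : VPerm} (hs : s ∈ ({x0, x1, c1} : Set VPerm)) (k : ℕ) :
      n ≤ wlen {x0, x1, c1} (s ^ k * g) + k := by
    have h2 := wlen_le_wlen_mul_add (pow_mem (Subgroup.subset_closure hs) k) hg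
    have h3 := wlen_le_length (S := {x0, x1, c1}) (l := List.replicate k s)
      fun x hx => .inl (List.eq_of_mem_replicate hx ▸ hs)
    rw [List.prod_replicate, List.length_replicate] at h3
    omega
  by_cases hv : PrefixReplaces g⁻¹ [true]
  · obtain ⟨u, hu⟩ := hv
    have hu' : ∀ ω, g (app u ω) = consSeq true ω := fun ω => by
      rw [← hu, ← Equiv.Perm.mul_apply, mul_inv_cancel]
      simp
    refine ⟨g, hg, u, hu', by omega, (FarPath.refl (by omega)).mono (Nat.zero_le _), fun k => ?_⟩
    rcases Nat.eq_zero_or_pos k with rfl | hk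
    · rw [pow_zero, one_mul]
      omega
    · have h2 := lt_wlen_x1_pow_mul H hD hg hu' hk
      have h3 := hpow (s := x1) (by simp) k
      omega
  · have hbad (i : ℕ) : ¬ PrefixReplaces (x0 ^ i * g)⁻¹ (List.replicate (i + 1) true) :=
      not_prefixReplaces_inv_mul hv fun ω => by
        rw [app_cons, app_nil, x0_pow_consSeq_true H, app_replicate_succ]
    have hlt (i : ℕ) : i + 1 < 3 * wlen {x0, x1, c1} (x0 ^ i * g) := by
      simpa using length_lt_of_not_prefixReplaces hD
        (mul_mem (pow_mem x0_mem_closure i) hg) (hbad i)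
    set j := 3 * n + 5 with hj
    have p1 := FarPath.pow_mul (S := {x0, x1, c1}) (m := m) (k := j) (s := x0) (a := g) (by simp)
      fun i _ => by
        have h2 := hlt i
        have h3 := hpow (s := x0) (by simp) i
        omega
    have hj' := hlt j
    have hmem := (p1.wlen_le hg).1
    have htm := halfTurn_mem_closure (x0 := x0) (x1 := x1) (c1 := c1)
    have ht : wlen {x0, x1, c1} (halfTurn x0 c1) ≤ 2 :=
      wlen_le_length (l := [x0⁻¹, c1⁻¹]) (by simp)
    have p2 := p1.trans (FarPath.mul_left hmem htm (m := m) (by omega))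
    have ham := (p2.wlen_le hg).1
    obtain ⟨u, hu⟩ := hasDepth_wlen hD (inv_mem hg) (List.replicate (j + 1) false) (by
      rw [wlen_inv hg, List.length_replicate]
      omega)
    refine ⟨_, ham, u, fun ω => ?_, ?_, p2.mono (by omega), fun k => ?_⟩
    · rw [Equiv.Perm.mul_apply, Equiv.Perm.mul_apply, ← hu, ← Equiv.Perm.mul_apply g,
        mul_inv_cancel, Equiv.Perm.one_apply, x0_pow_app_replicate_false H,
        halfTurn_consSeq_false H]
    · have := (p2.wlen_le hg).2
      omega
    · have h2 : ¬ PrefixReplaces (x1 ^ k * halfTurn x0 c1 * (x0 ^ j * g))⁻¹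
          (false :: List.replicate j true) :=
        not_prefixReplaces_inv_mul (hbad j) fun ω => by
          rw [app_replicate_succ', Equiv.Perm.mul_apply, halfTurn_consSeq_true H,
            x1_pow_consSeq H, if_neg (by simp), app_cons]
      have h3 := length_lt_of_not_prefixReplaces hD
        (mul_mem (mul_mem (pow_mem x1_mem_closure k) htm) hmem) h2
      rw [mul_assoc, List.length_cons, List.length_replicate] at h3
      omega

lemma exists_farPath_conjPow (H : IsGeneratingTriple x0 x1 c1)
    (hD : ∀ s ∈ ({x0, x1, c1} : Set VPerm), HasDepth s 3 ∧ HasDepth s⁻¹ 3) {g : VPerm}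
    (hg : g ∈ Subgroup.closure {x0, x1, c1}) {m : ℕ} (hm : m ≤ wlen {x0, x1, c1} g)
    (h1 : 1 ≤ wlen {x0, x1, c1} g) {k : ℕ} (hk : 100 * wlen {x0, x1, c1} g ≤ k) :
    ∃ a ∈ Subgroup.closure {x0, x1, c1}, ∃ c u, (∀ ω, a (app (c :: u) ω) = consSeq true ω) ∧
      wlen {x0, x1, c1} a ≤ 11 * wlen {x0, x1, c1} g ∧
      FarPath {x0, x1, c1} m g (21 * wlen {x0, x1, c1} g + k) (conjPow x1 a k) := by
  obtain ⟨a, ha, u, hu, hlen, p, hfar⟩ := exists_farPath_apply_eq_consSeq_true H hD hg hm h1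
  obtain ⟨c, u, rfl⟩ : ∃ c u', u = c :: u' := by
    refine List.exists_cons_of_ne_nil fun h => ?_
    have := nil_of_forall_apply_eq_app (g := a) (v := [true]) fun ω => by simpa [h] using hu ω
    simp at this
  have p1 := FarPath.pow_mul (S := {x0, x1, c1}) (k := k) (s := x1) (by simp) fun i _ => hfar i
  have h2 := lt_wlen_x1_pow_mul H hD ha hu (k := k) (by omega)
  have p2 := FarPath.mul_left (m := m) (mul_mem (pow_mem x1_mem_closure k) ha) (inv_mem ha) (by
    rw [wlen_inv ha]
    omega)
  rw [wlen_inv ha] at p2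
  exact ⟨a, ha, c, u, hu, hlen, ((p.trans p1).trans p2).mono (by omega)⟩

lemma exists_wlen_le_two_apply_eq_consSeq_true (H : IsGeneratingTriple x0 x1 c1) (c : Bool) :
    ∃ t ∈ Subgroup.closure {x0, x1, c1}, wlen {x0, x1, c1} t ≤ 2 ∧
      ∀ ω, t (app [c] ω) = consSeq true ω := by
  cases c with
  | false => exact ⟨halfTurn x0 c1, halfTurn_mem_closure,
      wlen_le_length (l := [x0⁻¹, c1⁻¹]) (by simp), fun ω => by
        rw [app_cons, app_nil, halfTurn_consSeq_false H]⟩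
  | true => exact ⟨1, one_mem _, (wlen_le_length (l := []) (by simp)).trans (by simp), by simp⟩

lemma exists_farPath (H : IsGeneratingTriple x0 x1 c1)
    (hD : ∀ s ∈ ({x0, x1, c1} : Set VPerm), HasDepth s 3 ∧ HasDepth s⁻¹ 3) {g h : VPerm}
    (hg : g ∈ Subgroup.closure {x0, x1, c1}) (hh : h ∈ Subgroup.closure {x0, x1, c1})
    (hg1 : 1 ≤ wlen {x0, x1, c1} g) (hh1 : 1 ≤ wlen {x0, x1, c1} h) :
    FarPath {x0, x1, c1} (min (wlen {x0, x1, c1} g) (wlen {x0, x1, c1} h)) g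
      (1000 * (wlen {x0, x1, c1} g + wlen {x0, x1, c1} h)) h := by
  set k := 100 * (wlen {x0, x1, c1} g + wlen {x0, x1, c1} h) with hk
  obtain ⟨a, ha, c, u, hu, hla, pa⟩ := exists_farPath_conjPow H hD hg
    (min_le_left _ (wlen {x0, x1, c1} h)) hg1 (k := k) (by omega)
  obtain ⟨b, hb, d, w, hw, hlb, pb⟩ := exists_farPath_conjPow H hD hh
    (min_le_right (wlen {x0, x1, c1} g) _) hh1 (k := k) (by omega)
  have hm := min_le_left (wlen {x0, x1, c1} g) (wlen {x0, x1, c1} h)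
  set m := min (wlen {x0, x1, c1} g) (wlen {x0, x1, c1} h)
  rcases eq_or_ne d (!c) with rfl | hdc
  · have p := FarPath.conjPow_conjPow H hD ha hb hu hw (m := m) (k := k)
      (by omega) (by omega) (by omega)
    exact ((pa.trans p).trans pb.symm).mono (by omega)
  · obtain rfl : d = c := by revert hdc; cases c <;> cases d <;> simp
    obtain ⟨t, htm, ht2, ht⟩ := exists_wlen_le_two_apply_eq_consSeq_true H (!d)
    have p := FarPath.conjPow_conjPow H hD ha htm hu ht (m := m) (k := k)
      (by omega) (by omega) (by omega)
    have q := FarPath.conjPow_conjPow H hD hb htm hw ht (m := m) (k := k)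
      (by omega) (by omega) (by omega)
    exact (((pa.trans p).trans q.symm).trans pb.symm).mono (by omega)

end Connecting

lemma represents_one : Represents 1 {([], [])} := by
  refine ⟨fun ω => ⟨([], []), ?_, ?_⟩, fun ω => ⟨([], []), ?_, ?_⟩, by simp⟩ <;>
    simp [IsPref]

lemma Nbr_one_le : Nbr 1 ≤ 1 :=
  Nat.sInf_le ⟨{([], [])}, represents_one, fun u v h => by simp at h, by simp⟩

lemma hasDepth_of_represents {g : VPerm} {T : Finset (List Bool × List Bool)}
    (h : Represents g T) {d : ℕ} (hd : ∀ p ∈ T, p.1.length ≤ d ∧ p.2.length ≤ d) :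
    HasDepth g d ∧ HasDepth g⁻¹ d := by
  refine ⟨h.hasDepth fun p hp => (hd p hp).1, h.inv.hasDepth fun p hp => ?_⟩
  obtain ⟨q, hq, rfl⟩ := Finset.mem_image.1 hp
  exact (hd q hq).2

/-- There exist `δ, D > 0` such that for all `g1, g2 ∈ T`
with `N(g1), N(g2) ≥ 4` there is a word `w` in the letters
`x0^{±1}, x1^{±1}, c1^{±1}` of length at most `D·(|g1|_B + |g2|_B)`, with
`g1·w = g2` (left-to-right products) and
`|g1·w'|_B ≥ δ·min{|g1|_B, |g2|_B}` for every prefix `w'` of `w`. -/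
theorem stmt18 (x0 x1 c1 : VPerm)
    (hx0 : Represents x0 x0T) (hx1 : Represents x1 x1T)
    (hc1 : Represents c1 c1T) :
    ∃ δ D : ℝ, 0 < δ ∧ 0 < D ∧
      ∀ g1 g2 : VPerm, InT g1 → InT g2 → 4 ≤ Nbr g1 → 4 ≤ Nbr g2 →
        ∃ w : List VPerm,
          (∀ x ∈ w, x = x0 ∨ x = x0⁻¹ ∨ x = x1 ∨ x = x1⁻¹ ∨ x = c1 ∨ x = c1⁻¹) ∧
          (w.length : ℝ) ≤
            D * ((wlen {x0, x1, c1} g1 : ℝ) + (wlen {x0, x1, c1} g2 : ℝ)) ∧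
          wordEval g1 w = g2 ∧
          (∀ w' : List VPerm, w' <+: w →
            δ * min (wlen {x0, x1, c1} g1 : ℝ) (wlen {x0, x1, c1} g2 : ℝ) ≤
              (wlen {x0, x1, c1} (wordEval g1 w') : ℝ)) := by
  have H := isGeneratingTriple_of_represents hx0 hx1 hc1
  have hD : ∀ s ∈ ({x0, x1, c1} : Set VPerm), HasDepth s 3 ∧ HasDepth s⁻¹ 3 := by
    rintro s (rfl | rfl | rfl)
    · exact hasDepth_of_represents hx0 (by decide)
    · exact hasDepth_of_represents hx1 (by decide)
    · exact hasDepth_of_represents hc1 (by decide)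
  have hpos {g : VPerm} (hg : g ∈ Subgroup.closure {x0, x1, c1}) (h4 : 4 ≤ Nbr g) :
      1 ≤ wlen {x0, x1, c1} g := by
    refine wlen_pos hg ?_
    rintro rfl
    have := Nbr_one_le
    omega
  refine ⟨1 / 4, 1000, by norm_num, by norm_num, fun g1 g2 hg1 hg2 h1 h2 => ?_⟩
  have hm1 := mem_closure_of_inT H hD hg1
  have hm2 := mem_closure_of_inT H hD hg2
  obtain ⟨w, hw, hlen, heq, hfar⟩ :=
    (exists_farPath H hD hm1 hm2 (hpos hm1 h1) (hpos hm2 h2)).exists_word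
  refine ⟨w, fun x hx => ?_, by exact_mod_cast hlen, heq, fun w' hw' => ?_⟩
  · have := hw x hx
    simp only [Set.mem_insert_iff, Set.mem_singleton_iff, inv_eq_iff_eq_inv] at this
    tauto
  · have : (min (wlen {x0, x1, c1} g1) (wlen {x0, x1, c1} g2) : ℝ) ≤
        4 * wlen {x0, x1, c1} (wordEval g1 w') := by exact_mod_cast hfar w' hw'
    linarith
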